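/- For z > 0 set z₁ = z/(e^z − 1) and z₂ = z·e^z/(e^z − 1). Then (i) z₂ − z₁ = z; (ii) z₁·e^{−z₁} = z₂·e^{−z₂}, i.e. the Gamma(2,1) density f(x) = x e^{−x} takes equal values at z₁ and z₂; and (iii) with F(x) = 1 − (1+x)e^{−x} the Gamma(2,1) cdf, F(z₂) − F(z₁) = e^{−z₁} − e^{−z₂} = exp(−z/(e^z−1)) − exp(−z·e^z/(e^z−1)). Hence the cdf of the decreasing rearrangement of the convolution of two independent standard exponential densities is F̃₅(z) = exp(−z/(e^z−1)) − exp(−z e^z/(e^z−1)). -/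

import Mathlib

theorem stmt_19 : ∀ z : ℝ, 0 < z →
    (z * Real.exp z / (Real.exp z - 1)) - (z / (Real.exp z - 1)) = z ∧
    (z / (Real.exp z - 1)) * Real.exp (-(z / (Real.exp z - 1))) =
      (z * Real.exp z / (Real.exp z - 1)) * Real.exp (-(z * Real.exp z / (Real.exp z - 1))) ∧
    (1 - (1 + z * Real.exp z / (Real.exp z - 1)) * Real.exp (-(z * Real.exp z / (Real.exp z - 1))))
      - (1 - (1 + z / (Real.exp z - 1)) * Real.exp (-(z / (Real.exp z - 1)))) =
      Real.exp (-(z / (Real.exp z - 1))) - Real.exp (-(z * Real.exp z / (Real.exp z - 1))) := by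
  intro z hz
  have hne : Real.exp z - 1 ≠ 0 := by
    have := Real.one_lt_exp_iff.mpr hz
    linarith
  have hsub : z * Real.exp z / (Real.exp z - 1) - z / (Real.exp z - 1) = z := by
    field_simp
  have hdensity : (z / (Real.exp z - 1)) * Real.exp (-(z / (Real.exp z - 1))) =
      (z * Real.exp z / (Real.exp z - 1)) *
        Real.exp (-(z * Real.exp z / (Real.exp z - 1))) := by
    have hexp : Real.exp (-(z / (Real.exp z - 1))) =
        Real.exp z * Real.exp (-(z * Real.exp z / (Real.exp z - 1))) := by
      rw [← Real.exp_add]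
      congr 1
      linarith
    rw [hexp]
    ring
  exact ⟨hsub, hdensity, by linarith⟩
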